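/- Let H̄=(H0,H1) be a compatible pair of complex Hilbert spaces with Δ(H̄) dense in both H0 and H1, so that each dual H_j* embeds injectively into Δ(H̄)* by restriction and H̄*=(H0*,H1*) is a compatible pair. Then for every 0<θ<1, with the normalisation N_{θ,2}=((2/π)sin(πθ))^{1/2}: a functional ψ∈Δ(H̄)* extends to a bounded linear functional on K_{θ,2}(H̄) if and only if ψ∈K_{θ,2}(H̄*), and in that case the dual norm of ψ on K_{θ,2}(H̄) equals ‖ψ‖_{K_{θ,2}(H̄*)}. -/

import Mathlib

open MeasureTheory Set Filter Topology
open scoped ENNReal NNReal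

noncomputable section

/-- The measure `dt/t` on `(0,∞)`. -/
def logMeasure : Measure ℝ :=
  (volume.restrict (Set.Ioi (0:ℝ))).withDensity (fun t => ENNReal.ofReal t⁻¹)

/-- The weighted norm `‖F‖_{θ,q} = (∫₀^∞ (t^{-θ} F(t))^q dt/t)^{1/q}`,
with the essential supremum convention for `q = ∞`. -/
def thetaNormE (θ : ℝ) (q : ℝ≥0∞) (F : ℝ → ℝ≥0∞) : ℝ≥0∞ :=
  if q = ⊤ then essSup (fun t => ENNReal.ofReal (t ^ (-θ)) * F t) logMeasure
  else (∫⁻ t, (ENNReal.ofReal (t ^ (-θ)) * F t) ^ q.toReal ∂logMeasure) ^ (1 / q.toReal)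

/-- `g(s) = s/√(1+s²)`. -/
def gfun (s : ℝ) : ℝ := s / Real.sqrt (1 + s ^ 2)

def gfunE (s : ℝ) : ℝ≥0∞ := ENNReal.ofReal (gfun s)

/-- A compatible pair of complex Banach spaces: `X0` and `X1` are complex Banach
spaces realised as linear subspaces (via injective linear maps) of a common
complex vector space `V`. -/
structure CompatiblePair (V : Type*) [AddCommGroup V] [Module ℂ V]
    (X0 : Type*) [NormedAddCommGroup X0] [NormedSpace ℂ X0] [CompleteSpace X0]
    (X1 : Type*) [NormedAddCommGroup X1] [NormedSpace ℂ X1] [CompleteSpace X1] where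
  j0 : X0 →ₗ[ℂ] V
  j1 : X1 →ₗ[ℂ] V
  inj0 : Function.Injective j0
  inj1 : Function.Injective j1

namespace CompatiblePair

variable {V X0 X1 : Type*} [AddCommGroup V] [Module ℂ V]
  [NormedAddCommGroup X0] [NormedSpace ℂ X0] [CompleteSpace X0]
  [NormedAddCommGroup X1] [NormedSpace ℂ X1] [CompleteSpace X1]
  (P : CompatiblePair V X0 X1)

/-- `Σ(X̄) = X0 + X1` as a subset of `V`. -/
def sigmaSet : Set V := {x | ∃ a b, P.j0 a + P.j1 b = x}

/-- `Δ(X̄) = X0 ∩ X1` as a subset of `V`. -/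
def deltaSet : Set V := Set.range P.j0 ∩ Set.range P.j1

/-- `‖x‖_{Σ(X̄)}` (with value `∞` off `Σ(X̄)`). -/
def normSigmaE (x : V) : ℝ≥0∞ :=
  sInf {r | ∃ a b, P.j0 a + P.j1 b = x ∧ r = ENNReal.ofReal (‖a‖ + ‖b‖)}

/-- `‖x‖_{Δ(X̄)} = max(‖x‖_{X0}, ‖x‖_{X1})` (with value `∞` off `Δ(X̄)`). -/
def normDeltaE (x : V) : ℝ≥0∞ :=
  sInf {r | ∃ a b, P.j0 a = x ∧ P.j1 b = x ∧ r = ENNReal.ofReal (max ‖a‖ ‖b‖)}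

/-- `‖x‖_{X0}` for `x` in (the image of) `X0` (with value `∞` otherwise). -/
def norm0E (x : V) : ℝ≥0∞ := sInf {r | ∃ a, P.j0 a = x ∧ r = ENNReal.ofReal ‖a‖}

/-- `‖x‖_{X1}` for `x` in (the image of) `X1` (with value `∞` otherwise). -/
def norm1E (x : V) : ℝ≥0∞ := sInf {r | ∃ b, P.j1 b = x ∧ r = ENNReal.ofReal ‖b‖}

/-- The K-functional `K(t,x) = inf {(‖a‖_{X0}² + t²‖b‖_{X1}²)^{1/2} : j0 a + j1 b = x}`. -/
def KfunE (t : ℝ) (x : V) : ℝ≥0∞ :=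
  sInf {r | ∃ a b, P.j0 a + P.j1 b = x ∧
    r = ENNReal.ofReal (Real.sqrt (‖a‖ ^ 2 + t ^ 2 * ‖b‖ ^ 2))}

/-- `‖K(·,x)‖_{θ,q}`. -/
def KquasinormE (θ : ℝ) (q : ℝ≥0∞) (x : V) : ℝ≥0∞ := thetaNormE θ q (fun t => P.KfunE t x)

/-- The underlying set of the interpolation space `K_{θ,q}(X̄)`. -/
def Kmem (θ : ℝ) (q : ℝ≥0∞) : Set V := {x | x ∈ P.sigmaSet ∧ P.KquasinormE θ q x < ⊤}

/-- The norm of `K_{θ,q}(X̄)`, with the normalisation `N_{θ,q} = ‖g‖_{θ,q}⁻¹`,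
`g(s) = s/√(1+s²)`. -/
def KnormE (θ : ℝ) (q : ℝ≥0∞) (x : V) : ℝ≥0∞ :=
  (thetaNormE θ q gfunE)⁻¹ * P.KquasinormE θ q x

/-- The norm of `K_{θ,2}(X̄)`, with the explicit normalisation
`N_{θ,2} = ((2/π) sin (πθ))^{1/2}`. -/
def Knorm2E (θ : ℝ) (x : V) : ℝ≥0∞ :=
  ENNReal.ofReal (Real.sqrt (2 / Real.pi * Real.sin (Real.pi * θ))) * P.KquasinormE θ 2 x

/-- The real-valued `K_{θ,2}` norm. -/
def Knorm2R (θ : ℝ) (x : V) : ℝ := (P.Knorm2E θ x).toReal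

/-- `Δ(X̄)` realised as a (normed) submodule of `X0 × X1` (with the max norm):
pairs `(a,b)` with `j0 a = j1 b`. -/
def deltaSub : Submodule ℂ (X0 × X1) where
  carrier := {p | P.j0 p.1 = P.j1 p.2}
  add_mem' := by
    intro p q hp hq
    simp only [Set.mem_setOf_eq] at *
    simp [map_add, hp, hq]
  zero_mem' := by simp
  smul_mem' := by
    intro c p hp
    simp only [Set.mem_setOf_eq] at *
    simp [_root_.map_smul, hp]

/-- The J-functional `J(t,φ) = (‖φ‖_{X0}² + t²‖φ‖_{X1}²)^{1/2}`. -/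
def Jfun (t : ℝ) (p : X0 × X1) : ℝ := Real.sqrt (‖p.1‖ ^ 2 + t ^ 2 * ‖p.2‖ ^ 2)

/-- `f : (0,∞) → Δ(X̄)` is a J-representation of `φ`: it is strongly measurable,
`∫_a^b ‖f(t)‖_Δ dt/t < ∞` for `0<a<b<∞`, `∫₀^∞ ‖f(t)‖_Σ dt/t < ∞`, and
`φ = ∫₀^∞ f(t) dt/t` with convergence in `Σ(X̄)`. -/
structure IsJRep (φ : V) (f : ℝ → P.deltaSub) : Prop where
  meas : AEStronglyMeasurable f (volume.restrict (Set.Ioi (0:ℝ)))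
  locInt : ∀ a b : ℝ, 0 < a → a < b →
    IntegrableOn (fun t => ‖f t‖ / t) (Set.Ioo a b)
  sigmaInt : ∫⁻ t in Set.Ioi (0:ℝ),
      P.normSigmaE (P.j0 ((f t : X0 × X1).1)) * ENNReal.ofReal t⁻¹ < ⊤
  conv : Tendsto (fun ab : ℝ × ℝ =>
      P.normSigmaE (φ - P.j0 (∫ t in Set.Ioo ab.1 ab.2, t⁻¹ • ((f t : X0 × X1).1))))
      ((𝓝[>] (0:ℝ)) ×ˢ atTop) (𝓝 0)

/-- `inf_f ‖J(·,f(·))‖_{θ,q}` over all J-representations of `φ` (`∞` if none). -/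
def JinfE (θ : ℝ) (q : ℝ≥0∞) (φ : V) : ℝ≥0∞ :=
  ⨅ (f : ℝ → P.deltaSub) (_ : P.IsJRep φ f),
    thetaNormE θ q (fun t => ENNReal.ofReal (Jfun t (f t : X0 × X1)))

/-- The underlying set of the interpolation space `J_{θ,q}(X̄)`. -/
def Jmem (θ : ℝ) (q : ℝ≥0∞) : Set V := {φ | P.JinfE θ q φ < ⊤}

/-- The norm of `J_{θ,q}(X̄)` with the normalisation `N_{θ,q*}⁻¹ = ‖g‖_{θ,q*}`,
where `q*` is the conjugate exponent of `q`. -/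
def JnormE (θ : ℝ) (q qstar : ℝ≥0∞) (φ : V) : ℝ≥0∞ :=
  thetaNormE θ qstar gfunE * P.JinfE θ q φ

/-- The norm of `J_{θ,2}(X̄)` with the explicit normalisation
`N_{θ,2}⁻¹ = ((2/π) sin (πθ))^{-1/2}`. -/
def Jnorm2E (θ : ℝ) (φ : V) : ℝ≥0∞ :=
  (ENNReal.ofReal (Real.sqrt (2 / Real.pi * Real.sin (Real.pi * θ))))⁻¹ * P.JinfE θ 2 φ

end CompatiblePair

namespace CompatiblePair

variable {V X0 X1 : Type*} [AddCommGroup V] [Module ℂ V]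
  [NormedAddCommGroup X0] [NormedSpace ℂ X0] [CompleteSpace X0]
  [NormedAddCommGroup X1] [NormedSpace ℂ X1] [CompleteSpace X1]
  (P : CompatiblePair V X0 X1)

/-- The continuous inclusion `Δ(X̄) → X0`. -/
def incl0 : P.deltaSub →L[ℂ] X0 :=
  (ContinuousLinearMap.fst ℂ X0 X1).comp P.deltaSub.subtypeL

/-- The continuous inclusion `Δ(X̄) → X1`. -/
def incl1 : P.deltaSub →L[ℂ] X1 :=
  (ContinuousLinearMap.snd ℂ X0 X1).comp P.deltaSub.subtypeL

/-- The embedding of `X0*` into `Δ(X̄)*` by restriction. -/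
def jd0 : (X0 →L[ℂ] ℂ) →ₗ[ℂ] (P.deltaSub →L[ℂ] ℂ) where
  toFun ψ := ψ.comp P.incl0
  map_add' := by intros; ext p; simp
  map_smul' := by intros; ext p; simp

/-- The embedding of `X1*` into `Δ(X̄)*` by restriction. -/
def jd1 : (X1 →L[ℂ] ℂ) →ₗ[ℂ] (P.deltaSub →L[ℂ] ℂ) where
  toFun ψ := ψ.comp P.incl1
  map_add' := by intros; ext p; simp
  map_smul' := by intros; ext p; simp

end CompatiblePair

theorem lintegral_exp_neg_mul_Ioi {c : ℝ} (hc : 0 < c) :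
    ∫⁻ x in Ioi (0:ℝ), ENNReal.ofReal (Real.exp (-(c * x))) = ENNReal.ofReal c⁻¹ := by
  have h := Real.integral_rpow_mul_exp_neg_mul_Ioi (a := 1) (r := c) one_pos hc
  have hi : IntegrableOn (fun x : ℝ => Real.exp (-(c * x))) (Ioi 0) := by
    have := integrableOn_rpow_mul_exp_neg_mul_rpow (p := 1) (s := 0) (b := c) (by norm_num) one_pos hc
    simpa using this
  rw [← ofReal_integral_eq_lintegral_ofReal hi (ae_of_all _ fun x => (Real.exp_pos _).le)]
  simpa using congrArg ENNReal.ofReal h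

theorem lintegral_rpow_mul_exp_neg_mul_rpow {p q b : ℝ} (hp : 0 < p) (hq : -1 < q) (hb : 0 < b) :
    ∫⁻ x in Ioi (0:ℝ), ENNReal.ofReal (x ^ q * Real.exp (-b * x ^ p)) =
      ENNReal.ofReal (b ^ (-(q + 1) / p) * (1 / p) * Real.Gamma ((q + 1) / p)) := by
  rw [← integral_rpow_mul_exp_neg_mul_rpow hp hq hb, ofReal_integral_eq_lintegral_ofReal
    (integrableOn_rpow_mul_exp_neg_mul_rpow hq hp hb)]
  filter_upwards [ae_restrict_mem measurableSet_Ioi] with x hx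
  have : 0 < x := hx
  positivity

theorem lintegral_rpow_div_sq_mul_add {θ a b : ℝ} (hθ0 : 0 < θ) (hθ1 : θ < 1)
    (ha : 0 < a) (hb : 0 < b) :
    ∫⁻ t in Ioi (0:ℝ), ENNReal.ofReal (t ^ (1 - 2 * θ) / (t ^ 2 * a + b)) =
      ENNReal.ofReal (Real.pi / (2 * Real.sin (Real.pi * θ)) * (a ^ (θ - 1) * b ^ (-θ))) := by
  calc
    _ = ∫⁻ t in Ioi (0:ℝ), ∫⁻ x in Ioi (0:ℝ),
          ENNReal.ofReal (t ^ (1 - 2 * θ) * Real.exp (-((t ^ 2 * a + b) * x))) := by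
      refine setLIntegral_congr_fun measurableSet_Ioi fun t ht => ?_
      have ht : 0 < t := ht
      have hc : 0 < t ^ 2 * a + b := by positivity
      simp_rw [ENNReal.ofReal_mul (Real.rpow_nonneg ht.le (1 - 2 * θ))]
      rw [lintegral_const_mul _ (by fun_prop), lintegral_exp_neg_mul_Ioi hc,
        ← ENNReal.ofReal_mul (Real.rpow_nonneg ht.le _), div_eq_mul_inv]
    _ = ∫⁻ x in Ioi (0:ℝ), ∫⁻ t in Ioi (0:ℝ),
          ENNReal.ofReal (t ^ (1 - 2 * θ) * Real.exp (-((t ^ 2 * a + b) * x))) := by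
      refine lintegral_lintegral_swap ?_
      have : Measurable (Function.uncurry fun t x : ℝ =>
          ENNReal.ofReal (t ^ (1 - 2 * θ) * Real.exp (-((t ^ 2 * a + b) * x)))) := by
        simp only [Function.uncurry_def]
        fun_prop
      exact this.aemeasurable
    _ = ∫⁻ x in Ioi (0:ℝ), ENNReal.ofReal (a ^ (θ - 1) * (1 / 2) * Real.Gamma (1 - θ)) *
          ENNReal.ofReal (x ^ (θ - 1) * Real.exp (-b * x ^ (1:ℝ))) := by
      refine setLIntegral_congr_fun measurableSet_Ioi fun x hx => ?_
      have hx : 0 < x := hx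
      have h := lintegral_rpow_mul_exp_neg_mul_rpow (p := 2) (q := 1 - 2 * θ) (b := a * x)
        two_pos (by linarith) (by positivity)
      have hG : 0 < Real.Gamma (1 - θ) := Real.Gamma_pos_of_pos (by linarith)
      calc
        _ = ∫⁻ t in Ioi (0:ℝ), ENNReal.ofReal (Real.exp (-b * x)) *
              ENNReal.ofReal (t ^ (1 - 2 * θ) * Real.exp (-(a * x) * t ^ (2:ℝ))) := by
          refine lintegral_congr fun t => ?_
          rw [← ENNReal.ofReal_mul (Real.exp_pos _).le, mul_left_comm, ← Real.exp_add,
            Real.rpow_two]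
          congr 3
          ring
        _ = _ := by
          rw [lintegral_const_mul _ (by fun_prop), h, ← ENNReal.ofReal_mul (Real.exp_pos _).le,
            ← ENNReal.ofReal_mul (by positivity), Real.rpow_one]
          congr 1
          rw [show -(1 - 2 * θ + 1) / 2 = θ - 1 by ring, show (1 - 2 * θ + 1) / 2 = 1 - θ by ring,
            Real.mul_rpow ha.le hx.le]
          ring
    _ = _ := by
      have hG : 0 < Real.Gamma (1 - θ) := Real.Gamma_pos_of_pos (by linarith)
      have hs : 0 < Real.sin (Real.pi * θ) :=
        Real.sin_pos_of_pos_of_lt_pi (by positivity) (by nlinarith [Real.pi_pos])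
      rw [lintegral_const_mul _ (by fun_prop), lintegral_rpow_mul_exp_neg_mul_rpow one_pos
        (by linarith) hb, ← ENNReal.ofReal_mul (by positivity)]
      congr 1
      have h := Real.Gamma_mul_Gamma_one_sub θ
      rw [sub_add_cancel, div_one, div_one, div_one, mul_one]
      calc
        _ = (Real.Gamma θ * Real.Gamma (1 - θ)) * (a ^ (θ - 1) * b ^ (-θ)) / 2 := by ring
        _ = _ := by rw [h]; field_simp

theorem lintegral_Ioi_rpow (s : ℝ) : ∫⁻ t in Ioi (0:ℝ), ENNReal.ofReal (t ^ s) = ⊤ := by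
  by_contra h
  refine not_integrableOn_Ioi_rpow s ⟨by fun_prop, ?_⟩
  rw [hasFiniteIntegral_iff_ofReal]
  · exact lt_top_iff_ne_top.2 h
  · filter_upwards [ae_restrict_mem measurableSet_Ioi] with x hx
    exact Real.rpow_nonneg (le_of_lt hx) _

/-- The normalised integral `(2/π) sin (πθ) ∫₀^∞ t^{1-2θ} / (t² a + b) dt`. -/
def resolventWeight (θ a b : ℝ) : ℝ≥0∞ :=
  ENNReal.ofReal (2 / Real.pi * Real.sin (Real.pi * θ)) *
    ∫⁻ t in Ioi (0:ℝ), ENNReal.ofReal (t ^ (1 - 2 * θ) / (t ^ 2 * a + b))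

theorem normalisation_pos {θ : ℝ} (hθ0 : 0 < θ) (hθ1 : θ < 1) :
    0 < 2 / Real.pi * Real.sin (Real.pi * θ) :=
  mul_pos (by positivity)
    (Real.sin_pos_of_pos_of_lt_pi (by positivity) (by nlinarith [Real.pi_pos]))

theorem resolventWeight_of_pos {θ a b : ℝ} (hθ0 : 0 < θ) (hθ1 : θ < 1) (ha : 0 < a) (hb : 0 < b) :
    resolventWeight θ a b = ENNReal.ofReal (a ^ (θ - 1) * b ^ (-θ)) := by
  have h := normalisation_pos hθ0 hθ1
  rw [resolventWeight, lintegral_rpow_div_sq_mul_add hθ0 hθ1 ha hb, ← ENNReal.ofReal_mul h.le]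
  congr 1
  have hs : Real.sin (Real.pi * θ) ≠ 0 := by
    rintro hs
    simp [hs] at h
  field_simp

theorem resolventWeight_zero_one {θ : ℝ} (hθ0 : 0 < θ) (hθ1 : θ < 1) :
    resolventWeight θ 0 1 = ⊤ := by
  have h := normalisation_pos hθ0 hθ1
  simp [resolventWeight, lintegral_Ioi_rpow, ENNReal.mul_top, h]

theorem resolventWeight_one_zero {θ : ℝ} (hθ0 : 0 < θ) (hθ1 : θ < 1) :
    resolventWeight θ 1 0 = ⊤ := by
  have h := normalisation_pos hθ0 hθ1
  have : ∫⁻ t in Ioi (0:ℝ), ENNReal.ofReal (t ^ (1 - 2 * θ) / (t ^ 2 * 1 + 0)) = ⊤ := by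
    rw [← lintegral_Ioi_rpow (1 - 2 * θ - 2)]
    refine setLIntegral_congr_fun measurableSet_Ioi fun t ht => ?_
    rw [Real.rpow_sub ht _ 2, Real.rpow_two, mul_one, add_zero]
  rw [resolventWeight, this, ENNReal.mul_top (by simpa using h)]

theorem thetaNormE_two (θ : ℝ) {F : ℝ → ℝ≥0∞} {v : ℝ → ℝ} (hv : ∀ t, 0 < t → 0 ≤ v t)
    (hF : ∀ t, 0 < t → F t = ENNReal.ofReal (Real.sqrt (t ^ 2 * v t))) :
    thetaNormE θ 2 F =
      (∫⁻ t in Ioi (0:ℝ), ENNReal.ofReal (t ^ (1 - 2 * θ)) * ENNReal.ofReal (v t)) ^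
        (1 / 2 : ℝ) := by
  rw [thetaNormE, if_neg (by simp), logMeasure,
    lintegral_withDensity_eq_lintegral_mul_non_measurable _ (by fun_prop) (by simp)]
  simp only [ENNReal.toReal_ofNat]
  congr 1
  refine setLIntegral_congr_fun measurableSet_Ioi fun t ht => ?_
  have ht : 0 < t := ht
  have := hv t ht
  simp only [Pi.mul_apply]
  rw [hF t ht, ← ENNReal.ofReal_mul (by positivity), ENNReal.ofReal_rpow_of_nonneg (by positivity)
    (by positivity), ← ENNReal.ofReal_mul (by positivity), ← ENNReal.ofReal_mul (by positivity),
    Real.rpow_two, mul_pow, Real.sq_sqrt (by positivity), ← Real.rpow_natCast (t ^ (-θ)),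
    ← Real.rpow_mul ht.le, show 1 - 2 * θ = -1 + -θ * (2:ℕ) + 2 by push_cast; ring,
    Real.rpow_add ht, Real.rpow_add ht, Real.rpow_neg_one, Real.rpow_two]
  congr 1
  ring

theorem ofReal_mul_thetaNormE_sq {θ : ℝ} (hθ0 : 0 < θ) (hθ1 : θ < 1)
    {μ : Measure ℝ} [IsFiniteMeasure μ] (hμ : ∀ᵐ x ∂μ, x ∈ Icc (0:ℝ) 1)
    {g a b : ℝ → ℝ} (hg : Continuous g) (ha : Continuous a) (hb : Continuous b)
    (hg0 : ∀ x ∈ Icc (0:ℝ) 1, 0 ≤ g x) (ha0 : ∀ x ∈ Icc (0:ℝ) 1, 0 ≤ a x)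
    (hb0 : ∀ x ∈ Icc (0:ℝ) 1, 0 ≤ b x)
    {F : ℝ → ℝ≥0∞}
    (hi : ∀ t, 0 < t → Integrable (fun x => g x / (t ^ 2 * a x + b x)) μ)
    (hF : ∀ t, 0 < t → F t =
      ENNReal.ofReal (Real.sqrt (t ^ 2 * ∫ x, g x / (t ^ 2 * a x + b x) ∂μ))) :
    (ENNReal.ofReal (Real.sqrt (2 / Real.pi * Real.sin (Real.pi * θ))) * thetaNormE θ 2 F) ^ 2 =
      ∫⁻ x, ENNReal.ofReal (g x) * resolventWeight θ (a x) (b x) ∂μ := by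
  have hnn : ∀ t, 0 < t → ∀ᵐ x ∂μ, 0 ≤ g x / (t ^ 2 * a x + b x) := fun t ht => by
    filter_upwards [hμ] with x hx
    have := hg0 x hx
    have := ha0 x hx
    have := hb0 x hx
    positivity
  rw [thetaNormE_two θ (fun t ht => integral_nonneg_of_ae (hnn t ht)) hF, mul_pow,
    ← ENNReal.ofReal_pow (Real.sqrt_nonneg _), Real.sq_sqrt (normalisation_pos hθ0 hθ1).le,
    ← ENNReal.rpow_natCast, ← ENNReal.rpow_mul]
  norm_num only [ENNReal.rpow_one]
  have hmeas : Measurable (Function.uncurry fun t x : ℝ => ENNReal.ofReal (t ^ (1 - 2 * θ)) *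
      ENNReal.ofReal (g x / (t ^ 2 * a x + b x))) := by
    simp only [Function.uncurry_def]
    fun_prop
  calc
    _ = ENNReal.ofReal (2 / Real.pi * Real.sin (Real.pi * θ)) *
        ∫⁻ t in Ioi (0:ℝ), ∫⁻ x, ENNReal.ofReal (t ^ (1 - 2 * θ)) *
          ENNReal.ofReal (g x / (t ^ 2 * a x + b x)) ∂μ := by
      congr 1
      refine setLIntegral_congr_fun measurableSet_Ioi fun t ht => ?_
      rw [ofReal_integral_eq_lintegral_ofReal (hi t ht) (hnn t ht),
        lintegral_const_mul _ (by fun_prop)]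
    _ = ENNReal.ofReal (2 / Real.pi * Real.sin (Real.pi * θ)) *
        ∫⁻ x, (∫⁻ t in Ioi (0:ℝ), ENNReal.ofReal (t ^ (1 - 2 * θ)) *
          ENNReal.ofReal (g x / (t ^ 2 * a x + b x))) ∂μ := by
      rw [lintegral_lintegral_swap hmeas.aemeasurable]
    _ = _ := by
      rw [← lintegral_const_mul]
      · refine lintegral_congr_ae ?_
        filter_upwards [hμ] with x hx
        rw [resolventWeight, mul_left_comm,
          ← lintegral_const_mul (ENNReal.ofReal (g x)) (by fun_prop)]
        congr 1
        refine setLIntegral_congr_fun measurableSet_Ioi fun t ht => ?_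
        have ht : 0 < t := ht
        rw [← ENNReal.ofReal_mul (by positivity),
          ← ENNReal.ofReal_mul (hg0 x hx)]
        congr 1
        ring
      · exact (hmeas.comp measurable_swap).lintegral_prod_right'

section SpectralMeasure

open scoped InnerProductSpace

variable {E : Type*} [NormedAddCommGroup E] [InnerProductSpace ℂ E] [CompleteSpace E]

theorem inner_cfc_left {A : E →L[ℂ] E} (f : ℝ → ℝ) (x y : E) :
    ⟪cfc f A x, y⟫_ℂ = ⟪x, cfc f A y⟫_ℂ := by
  have h : IsSelfAdjoint (cfc f A) := cfc_predicate f A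
  rw [← ContinuousLinearMap.adjoint_inner_right, h.adjoint_eq]

theorem cfc_apply_cfc {A : E →L[ℂ] E} {f g : ℝ → ℝ} (hf : ContinuousOn f (spectrum ℝ A))
    (hg : ContinuousOn g (spectrum ℝ A)) (x : E) :
    cfc f A (cfc g A x) = cfc (fun s => f s * g s) A x := by
  rw [cfc_mul f g A hf hg]
  rfl

/-- The spectral measure of a self-adjoint operator at a vector. -/
theorem exists_spectralMeasure {A : E →L[ℂ] E} (hA : IsSelfAdjoint A) (x : E) :
    ∃ μ : Measure ℝ, IsFiniteMeasure μ ∧ (∀ᵐ s ∂μ, s ∈ spectrum ℝ A) ∧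
      ∀ f : ℝ → ℝ, ContinuousOn f (spectrum ℝ A) →
        Integrable f μ ∧ ∫ s, f s ∂μ = (⟪x, cfc f A x⟫_ℂ).re := by
  have hcomp : IsCompact (spectrum ℝ A) := ContinuousFunctionalCalculus.isCompact_spectrum A
  have : CompactSpace (spectrum ℝ A) := isCompact_iff_compactSpace.1 hcomp
  let L : CompactlySupportedContinuousMap (spectrum ℝ A) ℝ →ₗ[ℝ] ℝ :=
    { toFun := fun f => (⟪x, cfcHom hA (f : C(spectrum ℝ A, ℝ)) x⟫_ℂ).re
      map_add' := fun f g => by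
        have : ((f + g : CompactlySupportedContinuousMap (spectrum ℝ A) ℝ) : C(spectrum ℝ A, ℝ)) =
          (f : C(spectrum ℝ A, ℝ)) + (g : C(spectrum ℝ A, ℝ)) := rfl
        simp [this, map_add]
      map_smul' := fun c f => by
        have : ((c • f : CompactlySupportedContinuousMap (spectrum ℝ A) ℝ) : C(spectrum ℝ A, ℝ)) =
          c • (f : C(spectrum ℝ A, ℝ)) := rfl
        rw [this, map_smul, smul_apply, ← Complex.coe_smul, inner_smul_right]
        simp }
  have hL : ∀ f, 0 ≤ f → 0 ≤ L f := fun f hf => by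
    let g : C(spectrum ℝ A, ℝ) := ⟨fun s => Real.sqrt (f s), by fun_prop⟩
    have hg : (f : C(spectrum ℝ A, ℝ)) = star g * g := by
      ext s
      exact (Real.mul_self_sqrt (hf s)).symm
    change 0 ≤ (⟪x, cfcHom hA (f : C(spectrum ℝ A, ℝ)) x⟫_ℂ).re
    rw [hg, map_mul, map_star, mul_apply_eq_comp,
      ContinuousLinearMap.star_eq_adjoint, ContinuousLinearMap.adjoint_inner_right]
    exact inner_self_nonneg (𝕜 := ℂ)
  let Λ := PositiveLinearMap.mk₀ L hL
  let ν := RealRMK.rieszMeasure Λ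
  have hν : ∀ f : CompactlySupportedContinuousMap (spectrum ℝ A) ℝ, ∫ s, f s ∂ν =
      (⟪x, cfcHom hA (f : C(spectrum ℝ A, ℝ)) x⟫_ℂ).re := RealRMK.integral_rieszMeasure Λ
  have : IsFiniteMeasure ν := inferInstance
  have hemb : MeasurableEmbedding (Subtype.val : spectrum ℝ A → ℝ) :=
    MeasurableEmbedding.subtype_coe hcomp.measurableSet
  refine ⟨ν.map Subtype.val, inferInstance, ?_, fun f hf => ?_⟩
  · rw [hemb.ae_map_iff]
    exact ae_of_all _ fun s => s.2
  · rw [hemb.integrable_map_iff, hemb.integral_map]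
    let F : C(spectrum ℝ A, ℝ) := ⟨fun s => f s, hf.domRestrict⟩
    constructor
    · exact F.continuous.integrable_of_hasCompactSupport (HasCompactSupport.of_compactSpace _)
    · rw [cfc_apply f A hA hf]
      exact hν ⟨F, HasCompactSupport.of_compactSpace _⟩

theorem norm_inner_sq_le_cfc {A : E →L[ℂ] E} (hA : IsSelfAdjoint A) {f : ℝ → ℝ}
    (hf : ContinuousOn f (spectrum ℝ A)) (hpos : ∀ s ∈ spectrum ℝ A, 0 < f s) (x y : E) :
    ‖⟪x, y⟫_ℂ‖ ^ 2 ≤ (⟪x, cfc (fun s => (f s)⁻¹) A x⟫_ℂ).re * (⟪y, cfc f A y⟫_ℂ).re := by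
  have hr : ContinuousOn (fun s => Real.sqrt (f s)) (spectrum ℝ A) := hf.sqrt
  have hr' : ContinuousOn (fun s => (Real.sqrt (f s))⁻¹) (spectrum ℝ A) :=
    hr.inv₀ fun s hs => (Real.sqrt_pos.2 (hpos s hs)).ne'
  have hsq : ∀ g : ℝ → ℝ, ContinuousOn g (spectrum ℝ A) → ∀ z,
      ‖cfc g A z‖ ^ 2 = (⟪z, cfc (fun s => g s * g s) A z⟫_ℂ).re := fun g hg z => by
    rw [← cfc_apply_cfc hg hg, ← inner_cfc_left]
    exact norm_sq_eq_re_inner (𝕜 := ℂ) _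
  have h1 : ⟪x, y⟫_ℂ = ⟪cfc (fun s => (Real.sqrt (f s))⁻¹) A x,
      cfc (fun s => Real.sqrt (f s)) A y⟫_ℂ := by
    rw [inner_cfc_left, cfc_apply_cfc hr' hr, cfc_congr (g := fun _ => (1:ℝ)), cfc_const_one ℝ A]
    · rfl
    · intro s hs
      exact inv_mul_cancel₀ (Real.sqrt_pos.2 (hpos s hs)).ne'
  have h2 : cfc (fun s => (f s)⁻¹) A =
      cfc (fun s => (Real.sqrt (f s))⁻¹ * (Real.sqrt (f s))⁻¹) A := cfc_congr fun s hs => by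
    rw [← mul_inv, Real.mul_self_sqrt (hpos s hs).le]
  have h3 : cfc f A = cfc (fun s => Real.sqrt (f s) * Real.sqrt (f s)) A :=
    cfc_congr fun s hs => (Real.mul_self_sqrt (hpos s hs).le).symm
  rw [h1, h2, h3, ← hsq _ hr', ← hsq _ hr, ← mul_pow]
  exact pow_le_pow_left₀ (norm_nonneg _) (norm_inner_le_norm _ _) 2

theorem norm_inner_sq_le_lintegral_inv {A : E →L[ℂ] E} (hA : IsSelfAdjoint A) {w : ℝ → ℝ}
    (hw : ContinuousOn w (spectrum ℝ A)) (hw0 : ∀ s ∈ spectrum ℝ A, 0 ≤ w s) (x y : E)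
    {μ : Measure ℝ} (hμ : ∀ᵐ s ∂μ, s ∈ spectrum ℝ A)
    (hμint : ∀ f : ℝ → ℝ, ContinuousOn f (spectrum ℝ A) →
        Integrable f μ ∧ ∫ s, f s ∂μ = (⟪x, cfc f A x⟫_ℂ).re)
    (hfin : ∫⁻ s, (ENNReal.ofReal (w s))⁻¹ ∂μ ≠ ⊤) :
    ‖⟪x, y⟫_ℂ‖ ^ 2 ≤ (∫⁻ s, (ENNReal.ofReal (w s))⁻¹ ∂μ).toReal * (⟪y, cfc w A y⟫_ℂ).re := by
  set m := ∫⁻ s, (ENNReal.ofReal (w s))⁻¹ ∂μ with hm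
  have key : ∀ ε : ℝ, 0 < ε →
      ‖⟪x, y⟫_ℂ‖ ^ 2 ≤ m.toReal * ((⟪y, cfc w A y⟫_ℂ).re + ε * ‖y‖ ^ 2) := fun ε hε => by
    have hc : ContinuousOn (fun s => w s + ε) (spectrum ℝ A) := hw.add continuousOn_const
    have hp : ∀ s ∈ spectrum ℝ A, 0 < w s + ε := fun s hs => by linarith [hw0 s hs]
    have hci : ContinuousOn (fun s => (w s + ε)⁻¹) (spectrum ℝ A) :=
      hc.inv₀ fun s hs => (hp s hs).ne'
    have h := norm_inner_sq_le_cfc hA hc hp x y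
    have h1 : (⟪x, cfc (fun s => (w s + ε)⁻¹) A x⟫_ℂ).re ≤ m.toReal := by
      rw [← (hμint _ hci).2, ← ENNReal.ofReal_le_iff_le_toReal hfin,
        ofReal_integral_eq_lintegral_ofReal (hμint _ hci).1]
      · refine lintegral_mono_ae ?_
        filter_upwards [hμ] with s hs
        rw [ENNReal.ofReal_inv_of_pos (hp s hs)]
        exact ENNReal.inv_le_inv.2 (ENNReal.ofReal_le_ofReal (by linarith))
      · filter_upwards [hμ] with s hs
        exact (inv_pos.2 (hp s hs)).le
    have h2 : (⟪y, cfc (fun s => w s + ε) A y⟫_ℂ).re =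
        (⟪y, cfc w A y⟫_ℂ).re + ε * ‖y‖ ^ 2 := by
      rw [cfc_add_const ε w A hw, Algebra.algebraMap_eq_smul_one, add_apply,
        inner_add_right, smul_apply, ← Complex.coe_smul,
        inner_smul_right, one_apply_eq_self, inner_self_eq_norm_sq_to_K]
      simp [← Complex.ofReal_pow]
    have h3 : 0 ≤ (⟪y, cfc (fun s => w s + ε) A y⟫_ℂ).re := by
      obtain ⟨ν, _, hν, hν'⟩ := exists_spectralMeasure hA y
      rw [← (hν' _ hc).2]
      refine integral_nonneg_of_ae ?_
      filter_upwards [hν] with s hs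
      exact (hp s hs).le
    rw [← h2]
    exact h.trans (mul_le_mul_of_nonneg_right h1 h3)
  have hlim : Tendsto (fun ε : ℝ => m.toReal * ((⟪y, cfc w A y⟫_ℂ).re + ε * ‖y‖ ^ 2)) (𝓝[>] 0)
      (𝓝 (m.toReal * ((⟪y, cfc w A y⟫_ℂ).re + 0 * ‖y‖ ^ 2))) :=
    (Continuous.tendsto (by fun_prop) _).mono_left nhdsWithin_le_nhds
  rw [zero_mul, add_zero] at hlim
  refine ge_of_tendsto hlim ?_
  filter_upwards [self_mem_nhdsWithin] with ε hε using key ε hε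

theorem lintegral_inv_le_of_norm_inner_sq_le {A : E →L[ℂ] E} {w : ℝ → ℝ}
    (hw : ContinuousOn w (spectrum ℝ A)) (hwm : Measurable w)
    (hw0 : ∀ s ∈ spectrum ℝ A, 0 ≤ w s) (x : E) {C : ℝ}
    (hC : ∀ y, ‖⟪x, y⟫_ℂ‖ ^ 2 ≤ C * (⟪y, cfc w A y⟫_ℂ).re)
    {μ : Measure ℝ} (hμ : ∀ᵐ s ∂μ, s ∈ spectrum ℝ A) (hC0 : 0 ≤ C)
    (hμint : ∀ f : ℝ → ℝ, ContinuousOn f (spectrum ℝ A) →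
        Integrable f μ ∧ ∫ s, f s ∂μ = (⟪x, cfc f A x⟫_ℂ).re) :
    ∫⁻ s, (ENNReal.ofReal (w s))⁻¹ ∂μ ≤ ENNReal.ofReal C := by
  have key : ∀ ε : ℝ, 0 < ε →
      ∫⁻ s, ENNReal.ofReal ((w s + ε)⁻¹) ∂μ ≤ ENNReal.ofReal C := fun ε hε => by
    have hc : ContinuousOn (fun s => w s + ε) (spectrum ℝ A) := hw.add continuousOn_const
    have hp : ∀ s ∈ spectrum ℝ A, 0 < w s + ε := fun s hs => by linarith [hw0 s hs]
    have hci : ContinuousOn (fun s => (w s + ε)⁻¹) (spectrum ℝ A) :=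
      hc.inv₀ fun s hs => (hp s hs).ne'
    have hwi : ContinuousOn (fun s => w s * (w s + ε)⁻¹) (spectrum ℝ A) := hw.mul hci
    have hcw : ContinuousOn (fun s => (w s + ε)⁻¹ * (w s * (w s + ε)⁻¹)) (spectrum ℝ A) :=
      hci.mul hwi
    have h0 : ∀ᵐ s ∂μ, 0 ≤ (w s + ε)⁻¹ := by
      filter_upwards [hμ] with s hs
      exact (inv_pos.2 (hp s hs)).le
    rw [← ofReal_integral_eq_lintegral_ofReal (hμint _ hci).1 h0]
    refine ENNReal.ofReal_le_ofReal ?_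
    have h := hC (cfc (fun s => (w s + ε)⁻¹) A x)
    rw [inner_cfc_left, cfc_apply_cfc hw hci, cfc_apply_cfc hci hwi,
      ← (hμint _ hcw).2] at h
    have h1 : ∫ s, (w s + ε)⁻¹ * (w s * (w s + ε)⁻¹) ∂μ ≤ ∫ s, (w s + ε)⁻¹ ∂μ := by
      refine integral_mono_ae (hμint _ hcw).1 (hμint _ hci).1 ?_
      filter_upwards [hμ] with s hs
      have := hp s hs
      refine mul_le_of_le_one_right (inv_pos.2 this).le ?_
      rw [← div_eq_mul_inv, div_le_one this]
      linarith
    have h2 : (∫ s, (w s + ε)⁻¹ ∂μ) ^ 2 ≤ ‖⟪x, cfc (fun s => (w s + ε)⁻¹) A x⟫_ℂ‖ ^ 2 := by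
      rw [(hμint _ hci).2]
      exact sq_le_sq.2 (by simpa using Complex.abs_re_le_norm _)
    have h3 : 0 ≤ ∫ s, (w s + ε)⁻¹ ∂μ := integral_nonneg_of_ae h0
    have h4 := h2.trans (h.trans (mul_le_mul_of_nonneg_left h1 hC0))
    rcases h3.eq_or_lt with h5 | h5
    · rwa [← h5]
    · nlinarith
  have hlim : ∀ s, Tendsto (fun n : ℕ => (ENNReal.ofReal (w s + 1 / ((n:ℝ) + 1)))⁻¹) atTop
      (𝓝 (ENNReal.ofReal (w s))⁻¹) := fun s => by
    refine (ENNReal.tendsto_ofReal ?_).inv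
    simpa using tendsto_const_nhds.add (tendsto_one_div_add_atTop_nhds_zero_nat (𝕜 := ℝ))
  calc
    _ = ∫⁻ s, liminf (fun n : ℕ => (ENNReal.ofReal (w s + 1 / ((n:ℝ) + 1)))⁻¹) atTop ∂μ :=
      lintegral_congr fun s => (hlim s).liminf_eq.symm
    _ ≤ liminf (fun n : ℕ => ∫⁻ s, (ENNReal.ofReal (w s + 1 / ((n:ℝ) + 1)))⁻¹ ∂μ) atTop :=
      lintegral_liminf_le fun n => by fun_prop
    _ ≤ liminf (fun _ : ℕ => ENNReal.ofReal C) atTop := by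
      refine liminf_le_liminf (Eventually.of_forall fun n => ?_)
      refine le_trans (le_of_eq (lintegral_congr_ae ?_)) (key (1 / ((n:ℝ) + 1)) (by positivity))
      filter_upwards [hμ] with s hs
      have := hw0 s hs
      rw [ENNReal.ofReal_inv_of_pos (by positivity)]
    _ = _ := by simp

end SpectralMeasure

section Splitting

open scoped InnerProductSpace

variable {E H0 H1 : Type*} [NormedAddCommGroup E] [InnerProductSpace ℂ E] [CompleteSpace E]
  [NormedAddCommGroup H0] [InnerProductSpace ℂ H0]
  [NormedAddCommGroup H1] [InnerProductSpace ℂ H1] [CompleteSpace H1]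

/-- The operator `T* T`. -/
def gramOp (T : E →L[ℂ] H1) : E →L[ℂ] E := T.adjoint ∘L T

theorem inner_gramOp (T : E →L[ℂ] H1) (x y : E) : ⟪x, gramOp T y⟫_ℂ = ⟪T x, T y⟫_ℂ :=
  T.adjoint_inner_right x (T y)

theorem isSelfAdjoint_gramOp (T : E →L[ℂ] H1) : IsSelfAdjoint (gramOp T) :=
  (ContinuousLinearMap.isPositive_adjoint_comp_self T).isSelfAdjoint

variable {T0 : E →L[ℂ] H0} {T1 : E →L[ℂ] H1}
  (hT : ∀ x y, ⟪T0 x, T0 y⟫_ℂ + ⟪T1 x, T1 y⟫_ℂ = ⟪x, y⟫_ℂ)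

include hT

theorem spectrum_gramOp_subset : spectrum ℝ (gramOp T1) ⊆ Icc 0 1 := by
  have h1 : ‖T1‖ ≤ 1 := T1.opNorm_le_bound zero_le_one fun x => by
    have h : ‖T0 x‖ ^ 2 + ‖T1 x‖ ^ 2 = ‖x‖ ^ 2 := by
      simp only [norm_sq_eq_re_inner (𝕜 := ℂ), ← map_add, hT]
    rw [one_mul]
    exact abs_le_of_sq_le_sq' (by nlinarith [sq_nonneg ‖T0 x‖]) (norm_nonneg _) |>.2
  intro s hs
  have hp := (ContinuousLinearMap.isPositive_adjoint_comp_self T1).spectrumRestricts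
  rw [SpectrumRestricts.nnreal_iff] at hp
  refine ⟨hp s hs, ?_⟩
  rcases subsingleton_or_nontrivial E with hE | hE
  · simp [spectrum.of_subsingleton] at hs
  have h2 := spectrum.norm_le_norm_of_mem hs
  rw [gramOp, ContinuousLinearMap.norm_adjoint_comp_self] at h2
  refine (le_abs_self s).trans (h2.trans ?_)
  nlinarith [norm_nonneg T1]

theorem inner_snd_cfc {f : ℝ → ℝ} (hf : ContinuousOn f (Icc 0 1)) (x y : E) :
    ⟪T1 x, T1 (cfc f (gramOp T1) y)⟫_ℂ = ⟪x, cfc (fun s => s * f s) (gramOp T1) y⟫_ℂ := by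
  have hA := isSelfAdjoint_gramOp T1
  rw [← inner_gramOp, cfc_mul (fun s => s) f (gramOp T1) (by fun_prop)
    (hf.mono (spectrum_gramOp_subset hT)), cfc_id' ℝ (gramOp T1)]
  rfl

theorem inner_fst_cfc {f : ℝ → ℝ} (hf : ContinuousOn f (Icc 0 1)) (x y : E) :
    ⟪T0 x, T0 (cfc f (gramOp T1) y)⟫_ℂ = ⟪x, cfc (fun s => (1 - s) * f s) (gramOp T1) y⟫_ℂ := by
  have hf' := hf.mono (spectrum_gramOp_subset hT)
  have h : cfc f (gramOp T1) = cfc (fun s => (1 - s) * f s) (gramOp T1) +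
      cfc (fun s => s * f s) (gramOp T1) := by
    rw [← cfc_add _ _ _ (by fun_prop) (by fun_prop)]
    congr 1
    ext s
    ring
  rw [eq_sub_of_add_eq (hT x _), inner_snd_cfc hT hf, h, add_apply,
    inner_add_right, add_sub_cancel_right]

theorem norm_snd_cfc_sq {f : ℝ → ℝ} (hf : ContinuousOn f (Icc 0 1)) (x : E) :
    ‖T1 (cfc f (gramOp T1) x)‖ ^ 2 =
      (⟪x, cfc (fun s => s * f s ^ 2) (gramOp T1) x⟫_ℂ).re := by
  have hf' := hf.mono (spectrum_gramOp_subset hT)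
  have h := norm_sq_eq_re_inner (𝕜 := ℂ) (T1 (cfc f (gramOp T1) x))
  rw [h, inner_snd_cfc hT hf, inner_cfc_left, cfc_apply_cfc hf' (by fun_prop)]
  congr! 5
  ring

theorem norm_fst_cfc_sq {f : ℝ → ℝ} (hf : ContinuousOn f (Icc 0 1)) (x : E) :
    ‖T0 (cfc f (gramOp T1) x)‖ ^ 2 =
      (⟪x, cfc (fun s => (1 - s) * f s ^ 2) (gramOp T1) x⟫_ℂ).re := by
  have hf' := hf.mono (spectrum_gramOp_subset hT)
  have h := norm_sq_eq_re_inner (𝕜 := ℂ) (T0 (cfc f (gramOp T1) x))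
  rw [h, inner_fst_cfc hT hf, inner_cfc_left, cfc_apply_cfc hf' (by fun_prop)]
  congr! 5
  ring

theorem sq_mul_norm_fst_add_norm_snd {f g k : ℝ → ℝ} {t : ℝ} (hf : ContinuousOn f (Icc 0 1))
    (hg : ContinuousOn g (Icc 0 1))
    (hk : ∀ s ∈ Icc (0:ℝ) 1, t ^ 2 * ((1 - s) * f s ^ 2) + s * g s ^ 2 = k s) (x : E) :
    t ^ 2 * ‖T0 (cfc f (gramOp T1) x)‖ ^ 2 + ‖T1 (cfc g (gramOp T1) x)‖ ^ 2 =
      (⟪x, cfc k (gramOp T1) x⟫_ℂ).re := by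
  have hs := spectrum_gramOp_subset hT
  have hf' := hf.mono hs
  have hg' := hg.mono hs
  have h : cfc k (gramOp T1) = (t ^ 2) • cfc (fun s => (1 - s) * f s ^ 2) (gramOp T1) +
      cfc (fun s => s * g s ^ 2) (gramOp T1) := by
    rw [← cfc_smul _ _ _ (by fun_prop), ← cfc_add _ _ _ (by fun_prop) (by fun_prop)]
    exact cfc_congr fun s h => (hk s (hs h)).symm
  rw [norm_fst_cfc_sq hT hf, norm_snd_cfc_sq hT hg, h, add_apply, inner_add_right, smul_apply,
    ← Complex.coe_smul, inner_smul_right]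
  simp [-Complex.ofReal_pow]

theorem sq_mul_inner_cfc_le_splitting {t : ℝ} (ht : 0 < t) (p q : E) :
    t ^ 2 * (⟪p, cfc (fun s => s * (1 - s) / (t ^ 2 * s + (1 - s))) (gramOp T1) p⟫_ℂ).re ≤
      ‖T0 (p - q)‖ ^ 2 + t ^ 2 * ‖T1 q‖ ^ 2 := by
  have hD : ∀ s ∈ Icc (0:ℝ) 1, t ^ 2 * s + (1 - s) ≠ 0 := fun s hs => by
    obtain ⟨h0, h1⟩ := hs
    rcases h0.eq_or_lt with rfl | h0
    · simp
    · have : 0 < t ^ 2 * s := by positivity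
      linarith
  have hf : ContinuousOn (fun s : ℝ => s / (t ^ 2 * s + (1 - s))) (Icc 0 1) :=
    ContinuousOn.div (by fun_prop) (by fun_prop) hD
  have hg : ContinuousOn (fun s : ℝ => (1 - s) / (t ^ 2 * s + (1 - s))) (Icc 0 1) :=
    ContinuousOn.div (by fun_prop) (by fun_prop) hD
  have hsq := sq_mul_norm_fst_add_norm_snd hT (t := t)
    (k := fun s => s * (1 - s) / (t ^ 2 * s + (1 - s))) hf hg (fun s hs => by
      have := hD s hs
      field_simp) p
  have h1 := inner_fst_cfc hT hf (p - q) p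
  have h2 := inner_snd_cfc hT hg q p
  set κ := (⟪p, cfc (fun s => s * (1 - s) / (t ^ 2 * s + (1 - s))) (gramOp T1) p⟫_ℂ).re with hκ
  set y := cfc (fun s : ℝ => s / (t ^ 2 * s + (1 - s))) (gramOp T1) p
  set z := cfc (fun s : ℝ => (1 - s) / (t ^ 2 * s + (1 - s))) (gramOp T1) p
  have h3 : κ = (⟪T0 (p - q), T0 y⟫_ℂ).re + (⟪T1 q, T1 z⟫_ℂ).re := by
    have e1 : (fun s : ℝ => (1 - s) * (s / (t ^ 2 * s + (1 - s)))) =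
        fun s => s * (1 - s) / (t ^ 2 * s + (1 - s)) := by ext s; ring
    have e2 : (fun s : ℝ => s * ((1 - s) / (t ^ 2 * s + (1 - s)))) =
        fun s => s * (1 - s) / (t ^ 2 * s + (1 - s)) := by ext s; ring
    rw [h1, h2, ← Complex.add_re, hκ, e1, e2, ← inner_add_left, sub_add_cancel]
  have h4 := re_inner_le_norm (𝕜 := ℂ) (T0 (p - q)) (T0 y)
  have h5 := re_inner_le_norm (𝕜 := ℂ) (T1 q) (T1 z)
  simp only [RCLike.re_to_complex] at h4 h5
  nlinarith [sq_nonneg (‖T0 (p - q)‖ - t ^ 2 * ‖T0 y‖), sq_nonneg (t * (‖T1 q‖ - ‖T1 z‖)),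
    mul_le_mul_of_nonneg_left h4 (sq_nonneg t), mul_le_mul_of_nonneg_left h5 (sq_nonneg t)]

theorem exists_splitting_eq {t : ℝ} (ht : 0 < t) (p : E) : ∃ q : E,
    ‖T0 (p - q)‖ ^ 2 + t ^ 2 * ‖T1 q‖ ^ 2 =
      t ^ 2 * (⟪p, cfc (fun s => s * (1 - s) / (t ^ 2 * s + (1 - s))) (gramOp T1) p⟫_ℂ).re := by
  have hs := spectrum_gramOp_subset hT
  have hA := isSelfAdjoint_gramOp T1
  have hD : ∀ s ∈ Icc (0:ℝ) 1, t ^ 2 * s + (1 - s) ≠ 0 := fun s hs => by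
    obtain ⟨h0, h1⟩ := hs
    rcases h0.eq_or_lt with rfl | h0
    · simp
    · have : 0 < t ^ 2 * s := by positivity
      linarith
  have hf : ContinuousOn (fun s : ℝ => s / (t ^ 2 * s + (1 - s))) (Icc 0 1) :=
    ContinuousOn.div (by fun_prop) (by fun_prop) hD
  have hg : ContinuousOn (fun s : ℝ => (1 - s) / (t ^ 2 * s + (1 - s))) (Icc 0 1) :=
    ContinuousOn.div (by fun_prop) (by fun_prop) hD
  have hsq := sq_mul_norm_fst_add_norm_snd hT (t := t)
    (k := fun s => s * (1 - s) / (t ^ 2 * s + (1 - s))) hf hg (fun s hs => by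
      have := hD s hs
      field_simp) p
  refine ⟨cfc (fun s : ℝ => (1 - s) / (t ^ 2 * s + (1 - s))) (gramOp T1) p, ?_⟩
  have hsum : p - cfc (fun s : ℝ => (1 - s) / (t ^ 2 * s + (1 - s))) (gramOp T1) p =
      (t ^ 2) • cfc (fun s : ℝ => s / (t ^ 2 * s + (1 - s))) (gramOp T1) p := by
    have : (1 : E →L[ℂ] E) = (t ^ 2) • cfc (fun s : ℝ => s / (t ^ 2 * s + (1 - s))) (gramOp T1) +
        cfc (fun s : ℝ => (1 - s) / (t ^ 2 * s + (1 - s))) (gramOp T1) := by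
      have hc : ContinuousOn (fun s : ℝ => (t ^ 2) • (s / (t ^ 2 * s + (1 - s))))
        (spectrum ℝ (gramOp T1)) := (hf.mono hs).fun_const_smul _
      rw [← cfc_smul _ _ _ (hf.mono hs), ← cfc_add _ _ _ hc (hg.mono hs),
        ← cfc_const_one ℝ (gramOp T1)]
      refine cfc_congr fun s h => ?_
      have := hD s (hs h)
      simp only [smul_eq_mul]
      field_simp
    have h := congrArg (fun S : E →L[ℂ] E => S p) this
    rw [sub_eq_iff_eq_add]
    exact h
  rw [← hsq, hsum, ← Complex.coe_smul, map_smul, norm_smul]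
  simp only [Complex.norm_real, norm_pow, Real.norm_eq_abs, sq_abs]
  ring

theorem dual_splitting {t : ℝ} (ht : 0 < t) (h : E) :
    (∀ (ψ0 : H0 →L[ℂ] ℂ) (ψ1 : H1 →L[ℂ] ℂ), (∀ x, ψ0 (T0 x) + ψ1 (T1 x) = ⟪h, x⟫_ℂ) →
      t ^ 2 * (⟪h, cfc (fun s => 1 / (t ^ 2 * (1 - s) + s)) (gramOp T1) h⟫_ℂ).re ≤
        ‖ψ0‖ ^ 2 + t ^ 2 * ‖ψ1‖ ^ 2) ∧
    ∃ (ψ0 : H0 →L[ℂ] ℂ) (ψ1 : H1 →L[ℂ] ℂ), (∀ x, ψ0 (T0 x) + ψ1 (T1 x) = ⟪h, x⟫_ℂ) ∧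
      ‖ψ0‖ ^ 2 + t ^ 2 * ‖ψ1‖ ^ 2 =
        t ^ 2 * (⟪h, cfc (fun s => 1 / (t ^ 2 * (1 - s) + s)) (gramOp T1) h⟫_ℂ).re := by
  have hs := spectrum_gramOp_subset hT
  have hA := isSelfAdjoint_gramOp T1
  have hD : ∀ s ∈ Icc (0:ℝ) 1, t ^ 2 * (1 - s) + s ≠ 0 := fun s hs => by
    obtain ⟨h0, h1⟩ := hs
    rcases h1.eq_or_lt with rfl | h1
    · simp
    · have : 0 < t ^ 2 * (1 - s) := mul_pos (by positivity) (by linarith)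
      linarith
  have hf : ContinuousOn (fun s : ℝ => 1 / (t ^ 2 * (1 - s) + s)) (Icc 0 1) :=
    ContinuousOn.div (by fun_prop) (by fun_prop) hD
  have hsq := sq_mul_norm_fst_add_norm_snd hT (t := t)
    (k := fun s => 1 / (t ^ 2 * (1 - s) + s)) hf hf (fun s hs => by
      have := hD s hs
      field_simp) h
  have hinner : ∀ x, (t ^ 2 : ℝ) * ⟪T0 (cfc (fun s => 1 / (t ^ 2 * (1 - s) + s)) (gramOp T1) h),
      T0 x⟫_ℂ + ⟪T1 (cfc (fun s => 1 / (t ^ 2 * (1 - s) + s)) (gramOp T1) h), T1 x⟫_ℂ =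
        ⟪h, x⟫_ℂ := fun x => by
    have hf' := hf.mono hs
    have hone : (1 : E →L[ℂ] E) =
        (t ^ 2) • cfc (fun s : ℝ => (1 - s) * (1 / (t ^ 2 * (1 - s) + s))) (gramOp T1) +
          cfc (fun s : ℝ => s * (1 / (t ^ 2 * (1 - s) + s))) (gramOp T1) := by
      have hc1 : ContinuousOn (fun s : ℝ => (1 - s) * (1 / (t ^ 2 * (1 - s) + s)))
        (spectrum ℝ (gramOp T1)) := ContinuousOn.mul (by fun_prop) hf'
      have hc2 : ContinuousOn (fun s : ℝ => s * (1 / (t ^ 2 * (1 - s) + s)))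
        (spectrum ℝ (gramOp T1)) := ContinuousOn.mul (by fun_prop) hf'
      have hc3 : ContinuousOn (fun s : ℝ => (t ^ 2) • ((1 - s) * (1 / (t ^ 2 * (1 - s) + s))))
        (spectrum ℝ (gramOp T1)) := hc1.fun_const_smul _
      rw [← cfc_smul _ _ _ hc1, ← cfc_add _ _ _ hc3 hc2,
        ← cfc_const_one ℝ (gramOp T1)]
      refine cfc_congr fun s h => ?_
      have := hD s (hs h)
      simp only [smul_eq_mul]
      field_simp
    have h1 := congrArg (fun S : E →L[ℂ] E => S h) hone
    simp only [one_apply_eq_self, add_apply, smul_apply] at h1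
    rw [← inner_conj_symm, inner_fst_cfc hT hf, ← inner_conj_symm (T1 _), inner_snd_cfc hT hf,
      ← inner_conj_symm h, ← Complex.conj_ofReal, ← map_mul, ← map_add, ← inner_smul_right,
      ← inner_add_right, Complex.coe_smul, ← h1]
  set κ := (⟪h, cfc (fun s => 1 / (t ^ 2 * (1 - s) + s)) (gramOp T1) h⟫_ℂ).re with hκ
  set y := cfc (fun s : ℝ => 1 / (t ^ 2 * (1 - s) + s)) (gramOp T1) h
  constructor
  · intro ψ0 ψ1 hψ
    have h3 : κ ≤ ‖ψ0‖ * ‖T0 y‖ + ‖ψ1‖ * ‖T1 y‖ := by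
      rw [hκ, ← hψ y]
      exact (Complex.re_le_norm _).trans ((norm_add_le _ _).trans
        (add_le_add (ψ0.le_opNorm _) (ψ1.le_opNorm _)))
    nlinarith [sq_nonneg (‖ψ0‖ - t ^ 2 * ‖T0 y‖), sq_nonneg (t * (‖ψ1‖ - ‖T1 y‖)),
      mul_le_mul_of_nonneg_left h3 (sq_nonneg t)]
  · refine ⟨((t ^ 2 : ℝ) : ℂ) • innerSL ℂ (T0 y), innerSL ℂ (T1 y), fun x => ?_, ?_⟩
    · simpa using hinner x
    · rw [norm_smul, innerSL_apply_norm, innerSL_apply_norm, ← hsq]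
      simp only [Complex.norm_real, norm_pow, Real.norm_eq_abs, sq_abs]
      ring

end Splitting

namespace CompatiblePair

open scoped InnerProductSpace

variable {V H0 H1 : Type*} [AddCommGroup V] [Module ℂ V]
  [NormedAddCommGroup H0] [InnerProductSpace ℂ H0] [CompleteSpace H0]
  [NormedAddCommGroup H1] [InnerProductSpace ℂ H1] [CompleteSpace H1]
  (P : CompatiblePair V H0 H1)

/-- The closure of `Δ(H̄)` in the Hilbert space `H0 ⊕ H1`, with its two coordinate maps. -/
theorem exists_hilbert_completion :
    ∃ (E : Submodule ℂ (WithLp 2 (H0 × H1))) (ι : P.deltaSub →L[ℂ] E)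
      (T0 : E →L[ℂ] H0) (T1 : E →L[ℂ] H1), CompleteSpace E ∧ DenseRange ι ∧
      IsUniformInducing ι ∧ (∀ p, T0 (ι p) = (p : H0 × H1).1) ∧
      (∀ p, T1 (ι p) = (p : H0 × H1).2) ∧
      ∀ x y, ⟪T0 x, T0 y⟫_ℂ + ⟪T1 x, T1 y⟫_ℂ = ⟪x, y⟫_ℂ := by
  let e := WithLp.prodContinuousLinearEquiv 2 ℂ H0 H1
  let D : Submodule ℂ (WithLp 2 (H0 × H1)) := P.deltaSub.map (e.symm : (H0 × H1) →ₗ[ℂ] _)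
  let j : P.deltaSub →L[ℂ] WithLp 2 (H0 × H1) := e.symm.toContinuousLinearMap ∘L P.deltaSub.subtypeL
  have hj : ∀ p, j p ∈ D.topologicalClosure := fun p =>
    D.le_topologicalClosure ⟨p, p.2, rfl⟩
  let S := D.topologicalClosure.subtypeL
  refine ⟨D.topologicalClosure, j.codRestrict _ hj,
    ContinuousLinearMap.fst ℂ H0 H1 ∘L e.toContinuousLinearMap ∘L S,
    ContinuousLinearMap.snd ℂ H0 H1 ∘L e.toContinuousLinearMap ∘L S,
    inferInstance, ?_, ?_, fun p => rfl, fun p => rfl, fun x y => rfl⟩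
  · intro x
    rw [Topology.IsInducing.subtypeVal.closure_eq_preimage_closure_image, mem_preimage]
    refine closure_mono ?_ x.2
    rintro _ ⟨p, hp, rfl⟩
    exact ⟨_, ⟨⟨p, hp⟩, rfl⟩, rfl⟩
  · refine IsUniformInducing.of_comp_iff isUniformEmbedding_subtype_val.isUniformInducing |>.1 ?_
    exact e.symm.isUniformEmbedding.isUniformInducing.comp
      isUniformEmbedding_subtype_val.isUniformInducing

variable {E : Type*} [NormedAddCommGroup E] [InnerProductSpace ℂ E] [CompleteSpace E]
  {ι : P.deltaSub →L[ℂ] E} {T0 : E →L[ℂ] H0} {T1 : E →L[ℂ] H1}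

theorem KfunE_eq (hT : ∀ x y, ⟪T0 x, T0 y⟫_ℂ + ⟪T1 x, T1 y⟫_ℂ = ⟪x, y⟫_ℂ)
    (hι : DenseRange ι) (h0 : ∀ p, T0 (ι p) = (p : H0 × H1).1)
    (h1 : ∀ p, T1 (ι p) = (p : H0 × H1).2) {t : ℝ} (ht : 0 < t) (p : P.deltaSub) :
    P.KfunE t (P.j0 (p : H0 × H1).1) = ENNReal.ofReal (Real.sqrt (t ^ 2 *
      (⟪ι p, cfc (fun s => s * (1 - s) / (t ^ 2 * s + (1 - s))) (gramOp T1) (ι p)⟫_ℂ).re)) := by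
  apply le_antisymm
  · have key : ∀ q : E, P.KfunE t (P.j0 (p : H0 × H1).1) ≤
        ENNReal.ofReal (Real.sqrt (‖T0 (ι p - q)‖ ^ 2 + t ^ 2 * ‖T1 q‖ ^ 2)) := fun q => by
      refine hι.induction_on
        (p := fun q => P.KfunE t (P.j0 (p : H0 × H1).1) ≤
          ENNReal.ofReal (Real.sqrt (‖T0 (ι p - q)‖ ^ 2 + t ^ 2 * ‖T1 q‖ ^ 2))) q ?_ ?_
      · exact isClosed_le continuous_const (ENNReal.continuous_ofReal.comp (by fun_prop))
      · intro q
        refine sInf_le ⟨(p - q : H0 × H1).1, (q : H0 × H1).2, ?_, ?_⟩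
        · have : P.j0 (q : H0 × H1).1 = P.j1 (q : H0 × H1).2 := q.2
          rw [Prod.fst_sub, map_sub, ← this, sub_add_cancel]
        · rw [← map_sub, h0, h1]
          rfl
    obtain ⟨q, hq⟩ := exists_splitting_eq hT ht (ι p)
    exact hq ▸ key q
  · refine le_sInf ?_
    rintro _ ⟨a, b, hab, rfl⟩
    refine ENNReal.ofReal_le_ofReal (Real.sqrt_le_sqrt ?_)
    let q : P.deltaSub := ⟨((p : H0 × H1).1 - a, b), by
      change P.j0 ((p : H0 × H1).1 - a) = P.j1 b
      rw [map_sub, ← hab, add_sub_cancel_left]⟩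
    have h := sq_mul_inner_cfc_le_splitting hT ht (ι p) (ι q)
    rw [← map_sub, h0, h1] at h
    simpa [q] using h

theorem KfunE_dual_eq (hT : ∀ x y, ⟪T0 x, T0 y⟫_ℂ + ⟪T1 x, T1 y⟫_ℂ = ⟪x, y⟫_ℂ)
    (hι : DenseRange ι) (h0 : ∀ p, T0 (ι p) = (p : H0 × H1).1)
    (h1 : ∀ p, T1 (ι p) = (p : H0 × H1).2) (i0 : Function.Injective P.jd0)
    (i1 : Function.Injective P.jd1) {ψ : P.deltaSub →L[ℂ] ℂ} {h : E}
    (hψ : ∀ p, ψ p = ⟪h, ι p⟫_ℂ) {t : ℝ} (ht : 0 < t) :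
    (CompatiblePair.mk P.jd0 P.jd1 i0 i1).KfunE t ψ = ENNReal.ofReal (Real.sqrt (t ^ 2 *
      (⟪h, cfc (fun s => 1 / (t ^ 2 * (1 - s) + s)) (gramOp T1) h⟫_ℂ).re)) := by
  obtain ⟨hle, ψ0, ψ1, hs, he⟩ := dual_splitting hT ht h
  apply le_antisymm
  · refine sInf_le ⟨ψ0, ψ1, ?_, by rw [he]⟩
    ext p
    rw [hψ, ← hs, h0, h1]
    rfl
  · refine le_sInf ?_
    rintro _ ⟨a, b, hab, rfl⟩
    refine ENNReal.ofReal_le_ofReal (Real.sqrt_le_sqrt (hle a b fun x => ?_))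
    refine hι.induction_on (p := fun x => a (T0 x) + b (T1 x) = ⟪h, x⟫_ℂ) x ?_ ?_
    · exact isClosed_eq (by fun_prop) (by fun_prop)
    · intro p
      rw [← hψ, h0, h1, ← hab]
      rfl

/-- The spectral multiplier of the `K_{θ,2}` norm. -/
def powerWeight (θ s : ℝ) : ℝ := s ^ θ * (1 - s) ^ (1 - θ)

theorem continuous_powerWeight {θ : ℝ} (hθ0 : 0 < θ) (hθ1 : θ < 1) :
    Continuous (powerWeight θ) :=
  (continuous_id.rpow_const fun _ => Or.inr hθ0.le).mul
    ((continuous_const.sub continuous_id).rpow_const fun _ => Or.inr (by linarith))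

theorem powerWeight_nonneg (θ : ℝ) {s : ℝ} (hs : s ∈ Icc (0:ℝ) 1) : 0 ≤ powerWeight θ s :=
  mul_nonneg (Real.rpow_nonneg hs.1 _) (Real.rpow_nonneg (sub_nonneg.2 hs.2) _)

theorem ofReal_mul_resolventWeight {θ : ℝ} (hθ0 : 0 < θ) (hθ1 : θ < 1) {s : ℝ}
    (hs : s ∈ Icc (0:ℝ) 1) :
    ENNReal.ofReal (s * (1 - s)) * resolventWeight θ s (1 - s) =
      ENNReal.ofReal (powerWeight θ s) := by
  rcases hs.1.eq_or_lt with rfl | h0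
  · simp [powerWeight, Real.zero_rpow hθ0.ne']
  rcases hs.2.eq_or_lt with rfl | h1
  · simp [powerWeight, Real.zero_rpow (sub_pos.2 hθ1).ne']
  have h1' : 0 < 1 - s := sub_pos.2 h1
  rw [resolventWeight_of_pos hθ0 hθ1 h0 h1', ← ENNReal.ofReal_mul (by positivity), powerWeight,
    Real.rpow_sub_one h0.ne', sub_eq_add_neg 1 θ, Real.rpow_add h1', Real.rpow_one]
  congr 1
  field_simp

theorem resolventWeight_eq_inv {θ : ℝ} (hθ0 : 0 < θ) (hθ1 : θ < 1) {s : ℝ}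
    (hs : s ∈ Icc (0:ℝ) 1) :
    resolventWeight θ (1 - s) s = (ENNReal.ofReal (powerWeight θ s))⁻¹ := by
  rcases hs.1.eq_or_lt with rfl | h0
  · simp [powerWeight, Real.zero_rpow hθ0.ne', resolventWeight_one_zero hθ0 hθ1]
  rcases hs.2.eq_or_lt with rfl | h1
  · simp [powerWeight, Real.zero_rpow (sub_pos.2 hθ1).ne', resolventWeight_zero_one hθ0 hθ1]
  have h1' : 0 < 1 - s := sub_pos.2 h1
  rw [resolventWeight_of_pos hθ0 hθ1 h1' h0, powerWeight,
    ← ENNReal.ofReal_inv_of_pos (by positivity), mul_inv, ← Real.rpow_neg h0.le,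
    ← Real.rpow_neg h1'.le, neg_sub, mul_comm]

theorem Knorm2E_sq {θ : ℝ} (hθ0 : 0 < θ) (hθ1 : θ < 1)
    (hT : ∀ x y, ⟪T0 x, T0 y⟫_ℂ + ⟪T1 x, T1 y⟫_ℂ = ⟪x, y⟫_ℂ)
    (hι : DenseRange ι) (h0 : ∀ p, T0 (ι p) = (p : H0 × H1).1)
    (h1 : ∀ p, T1 (ι p) = (p : H0 × H1).2) (p : P.deltaSub) :
    P.Knorm2E θ (P.j0 (p : H0 × H1).1) ^ 2 =
      ENNReal.ofReal (⟪ι p, cfc (powerWeight θ) (gramOp T1) (ι p)⟫_ℂ).re ∧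
    0 ≤ (⟪ι p, cfc (powerWeight θ) (gramOp T1) (ι p)⟫_ℂ).re := by
  have hs := spectrum_gramOp_subset hT
  obtain ⟨μ, _, hμ, hμint⟩ := exists_spectralMeasure (isSelfAdjoint_gramOp T1) (ι p)
  have hμ' : ∀ᵐ s ∂μ, s ∈ Icc (0:ℝ) 1 := hμ.mono fun s h => hs h
  have hc : ∀ t : ℝ, 0 < t → ContinuousOn (fun s : ℝ => s * (1 - s) / (t ^ 2 * s + (1 - s)))
      (spectrum ℝ (gramOp T1)) := fun t ht => by
    refine ContinuousOn.div (by fun_prop) (by fun_prop) fun s h => ?_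
    obtain ⟨h0, h1⟩ := hs h
    rcases h0.eq_or_lt with rfl | h0
    · simp
    · have : 0 < t ^ 2 * s := by positivity
      linarith
  have hw := hμint _ (continuous_powerWeight hθ0 hθ1).continuousOn
  have hw0 : ∀ᵐ s ∂μ, 0 ≤ powerWeight θ s := hμ'.mono fun s h => powerWeight_nonneg θ h
  refine ⟨?_, hw.2 ▸ integral_nonneg_of_ae hw0⟩
  rw [Knorm2E, KquasinormE, ofReal_mul_thetaNormE_sq hθ0 hθ1 hμ' (g := fun s => s * (1 - s))
    (a := fun s => s) (b := fun s => 1 - s) (by fun_prop) (by fun_prop) (by fun_prop)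
    (fun s hs => mul_nonneg hs.1 (sub_nonneg.2 hs.2)) (fun s hs => hs.1)
    (fun s hs => sub_nonneg.2 hs.2) (fun t ht => (hμint _ (hc t ht)).1)
    (fun t ht => by rw [P.KfunE_eq hT hι h0 h1 ht, (hμint _ (hc t ht)).2]),
    ← hw.2, ofReal_integral_eq_lintegral_ofReal hw.1 hw0]
  exact lintegral_congr_ae (hμ'.mono fun s h => ofReal_mul_resolventWeight hθ0 hθ1 h)

theorem Knorm2E_dual_sq {θ : ℝ} (hθ0 : 0 < θ) (hθ1 : θ < 1)
    (hT : ∀ x y, ⟪T0 x, T0 y⟫_ℂ + ⟪T1 x, T1 y⟫_ℂ = ⟪x, y⟫_ℂ)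
    (hι : DenseRange ι) (h0 : ∀ p, T0 (ι p) = (p : H0 × H1).1)
    (h1 : ∀ p, T1 (ι p) = (p : H0 × H1).2) (i0 : Function.Injective P.jd0)
    (i1 : Function.Injective P.jd1) {ψ : P.deltaSub →L[ℂ] ℂ} {h : E}
    (hψ : ∀ p, ψ p = ⟪h, ι p⟫_ℂ) {μ : Measure ℝ} [IsFiniteMeasure μ]
    (hμ : ∀ᵐ s ∂μ, s ∈ spectrum ℝ (gramOp T1))
    (hμint : ∀ f : ℝ → ℝ, ContinuousOn f (spectrum ℝ (gramOp T1)) →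
        Integrable f μ ∧ ∫ s, f s ∂μ = (⟪h, cfc f (gramOp T1) h⟫_ℂ).re) :
    (CompatiblePair.mk P.jd0 P.jd1 i0 i1).Knorm2E θ ψ ^ 2 =
      ∫⁻ s, (ENNReal.ofReal (powerWeight θ s))⁻¹ ∂μ := by
  have hs := spectrum_gramOp_subset hT
  have hμ' : ∀ᵐ s ∂μ, s ∈ Icc (0:ℝ) 1 := hμ.mono fun s h => hs h
  have hc : ∀ t : ℝ, 0 < t → ContinuousOn (fun s : ℝ => 1 / (t ^ 2 * (1 - s) + s))
      (spectrum ℝ (gramOp T1)) := fun t ht => by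
    refine ContinuousOn.div (by fun_prop) (by fun_prop) fun s h => ?_
    obtain ⟨h0, h1⟩ := hs h
    rcases h1.eq_or_lt with rfl | h1
    · simp
    · have : 0 < t ^ 2 * (1 - s) := mul_pos (by positivity) (by linarith)
      linarith
  rw [Knorm2E, KquasinormE, ofReal_mul_thetaNormE_sq hθ0 hθ1 hμ' (g := fun _ => 1)
    (a := fun s => 1 - s) (b := fun s => s) (by fun_prop) (by fun_prop) (by fun_prop)
    (fun s hs => zero_le_one) (fun s hs => sub_nonneg.2 hs.2) (fun s hs => hs.1)
    (fun t ht => (hμint _ (hc t ht)).1)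
    (fun t ht => by rw [P.KfunE_dual_eq hT hι h0 h1 i0 i1 hψ ht, (hμint _ (hc t ht)).2])]
  refine lintegral_congr_ae (hμ'.mono fun s h => ?_)
  simp [resolventWeight_eq_inv hθ0 hθ1 h]

theorem mem_Kmem_dual_iff {θ : ℝ} (hθ0 : 0 < θ) (hθ1 : θ < 1)
    (hT : ∀ x y, ⟪T0 x, T0 y⟫_ℂ + ⟪T1 x, T1 y⟫_ℂ = ⟪x, y⟫_ℂ)
    (h0 : ∀ p, T0 (ι p) = (p : H0 × H1).1)
    (h1 : ∀ p, T1 (ι p) = (p : H0 × H1).2) (i0 : Function.Injective P.jd0)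
    (i1 : Function.Injective P.jd1) {ψ : P.deltaSub →L[ℂ] ℂ} {h : E}
    (hψ : ∀ p, ψ p = ⟪h, ι p⟫_ℂ) :
    ψ ∈ (CompatiblePair.mk P.jd0 P.jd1 i0 i1).Kmem θ 2 ↔
      (CompatiblePair.mk P.jd0 P.jd1 i0 i1).Knorm2E θ ψ ≠ ⊤ := by
  have hn := Real.sqrt_pos.2 (normalisation_pos hθ0 hθ1)
  obtain ⟨-, ψ0, ψ1, hs, -⟩ := dual_splitting hT one_pos h
  have hsig : ψ ∈ (CompatiblePair.mk P.jd0 P.jd1 i0 i1).sigmaSet := ⟨ψ0, ψ1, by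
    ext p
    rw [hψ, ← hs, h0, h1]
    rfl⟩
  rw [Kmem, Knorm2E, Ne, ENNReal.mul_eq_top]
  simp [hsig, hn.not_ge, lt_top_iff_ne_top]

end CompatiblePair

namespace CompatiblePair

section Injective

variable {V X0 X1 : Type*} [AddCommGroup V] [Module ℂ V]
  [NormedAddCommGroup X0] [NormedSpace ℂ X0] [CompleteSpace X0]
  [NormedAddCommGroup X1] [NormedSpace ℂ X1] [CompleteSpace X1]
  (P : CompatiblePair V X0 X1)

theorem jd0_injective
    (hdense : ∀ (a : X0) (ε : ℝ), 0 < ε → ∃ p : P.deltaSub, ‖a - (p : X0 × X1).1‖ < ε) :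
    Function.Injective P.jd0 := by
  have hd : DenseRange P.incl0 := fun a => Metric.mem_closure_range_iff.2 fun ε hε => by
    simp only [dist_eq_norm]
    exact hdense a ε hε
  intro f g hfg
  exact ContinuousLinearMap.coeFn_injective
    (hd.equalizer f.continuous g.continuous (congrArg DFunLike.coe hfg))

theorem jd1_injective
    (hdense : ∀ (b : X1) (ε : ℝ), 0 < ε → ∃ p : P.deltaSub, ‖b - (p : X0 × X1).2‖ < ε) :
    Function.Injective P.jd1 := by
  have hd : DenseRange P.incl1 := fun b => Metric.mem_closure_range_iff.2 fun ε hε => by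
    simp only [dist_eq_norm]
    exact hdense b ε hε
  intro f g hfg
  exact ContinuousLinearMap.coeFn_injective
    (hd.equalizer f.continuous g.continuous (congrArg DFunLike.coe hfg))

end Injective

open scoped InnerProductSpace

variable {V H0 H1 : Type*} [AddCommGroup V] [Module ℂ V]
  [NormedAddCommGroup H0] [InnerProductSpace ℂ H0] [CompleteSpace H0]
  [NormedAddCommGroup H1] [InnerProductSpace ℂ H1] [CompleteSpace H1]
  (P : CompatiblePair V H0 H1)

variable {E : Type*} [NormedAddCommGroup E] [InnerProductSpace ℂ E] [CompleteSpace E]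
  {ι : P.deltaSub →L[ℂ] E} {T0 : E →L[ℂ] H0} {T1 : E →L[ℂ] H1}

theorem Knorm2E_duality_of_completion {θ : ℝ} (hθ0 : 0 < θ) (hθ1 : θ < 1)
    (hT : ∀ x y, ⟪T0 x, T0 y⟫_ℂ + ⟪T1 x, T1 y⟫_ℂ = ⟪x, y⟫_ℂ)
    (hι : DenseRange ι) (hu : IsUniformInducing ι) (h0 : ∀ p, T0 (ι p) = (p : H0 × H1).1)
    (h1 : ∀ p, T1 (ι p) = (p : H0 × H1).2)
    (i0 : Function.Injective P.jd0) (i1 : Function.Injective P.jd1) (ψ : P.deltaSub →L[ℂ] ℂ) :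
    ∃ N : P.deltaSub → ℝ,
      (∀ p, 0 ≤ N p ∧ P.Knorm2E θ (P.j0 (p : H0 × H1).1) = ENNReal.ofReal (N p)) ∧
      (∀ (c : ℝ) p, 0 ≤ c → N ((c : ℂ) • p) = c * N p) ∧
      (ψ ∈ (CompatiblePair.mk P.jd0 P.jd1 i0 i1).Kmem θ 2 ↔
        (CompatiblePair.mk P.jd0 P.jd1 i0 i1).Knorm2E θ ψ ≠ ⊤) ∧
      ((CompatiblePair.mk P.jd0 P.jd1 i0 i1).Knorm2E θ ψ ≠ ⊤ →
        ∀ p, ‖ψ p‖ ≤ ((CompatiblePair.mk P.jd0 P.jd1 i0 i1).Knorm2E θ ψ).toReal * N p) ∧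
      ∀ C : ℝ, 0 ≤ C → (∀ p, ‖ψ p‖ ≤ C * N p) →
        (CompatiblePair.mk P.jd0 P.jd1 i0 i1).Knorm2E θ ψ ≤ ENNReal.ofReal C := by
  let h : E := (InnerProductSpace.toDual ℂ E).symm (ψ.extend ι)
  have hψ : ∀ p, ψ p = ⟪h, ι p⟫_ℂ := fun p => by
    rw [InnerProductSpace.toDual_symm_apply, ContinuousLinearMap.extend_eq _ hι hu]
  have hw := (continuous_powerWeight hθ0 hθ1).continuousOn (s := spectrum ℝ (gramOp T1))
  have hw0 : ∀ s ∈ spectrum ℝ (gramOp T1), 0 ≤ powerWeight θ s := fun s hs =>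
    powerWeight_nonneg θ (spectrum_gramOp_subset hT hs)
  obtain ⟨μ, _, hμ, hμint⟩ := exists_spectralMeasure (isSelfAdjoint_gramOp T1) h
  have hM := P.Knorm2E_dual_sq hθ0 hθ1 hT hι h0 h1 i0 i1 hψ hμ hμint
  have hN := P.Knorm2E_sq hθ0 hθ1 hT hι h0 h1
  refine ⟨fun p => Real.sqrt (⟪ι p, cfc (powerWeight θ) (gramOp T1) (ι p)⟫_ℂ).re,
    fun p => ⟨Real.sqrt_nonneg _, ?_⟩, fun c p hc => ?_,
    P.mem_Kmem_dual_iff hθ0 hθ1 hT h0 h1 i0 i1 hψ, fun hfin p => ?_, fun C hC hb => ?_⟩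
  · rw [← ENNReal.pow_right_strictMono two_ne_zero |>.injective.eq_iff, (hN p).1,
      ← ENNReal.ofReal_pow (Real.sqrt_nonneg _), Real.sq_sqrt (hN p).2]
  · rw [← Real.sqrt_sq hc, ← Real.sqrt_mul (sq_nonneg c), Real.sqrt_sq hc]
    simp only [map_smul, inner_smul_left, inner_smul_right, Complex.conj_ofReal,
      Complex.re_ofReal_mul]
    rw [← mul_assoc, sq]
  · have h2 := norm_inner_sq_le_lintegral_inv (isSelfAdjoint_gramOp T1) hw hw0 h (ι p) hμ hμint
      (hM ▸ ENNReal.pow_ne_top hfin)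
    rw [← hψ, ← hM, ENNReal.toReal_pow] at h2
    refine le_of_sq_le_sq ?_ (by positivity)
    rwa [mul_pow, Real.sq_sqrt (hN p).2]
  · refine (ENNReal.pow_le_pow_left_iff two_ne_zero).1 ?_
    rw [hM, ← ENNReal.ofReal_pow hC]
    refine lintegral_inv_le_of_norm_inner_sq_le hw (continuous_powerWeight hθ0 hθ1).measurable hw0 h
      (fun y => ?_) hμ (sq_nonneg C) hμint
    refine hι.induction_on (p := fun y => ‖⟪h, y⟫_ℂ‖ ^ 2 ≤
      C ^ 2 * (⟪y, cfc (powerWeight θ) (gramOp T1) y⟫_ℂ).re) y ?_ fun p => ?_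
    · exact isClosed_le (by fun_prop) (by fun_prop)
    · rw [← hψ, ← Real.sq_sqrt (hN p).2, ← mul_pow]
      exact pow_le_pow_left₀ (norm_nonneg _) (hb p) 2

/-- On `Δ(H̄)` the `K_{θ,2}` norm is a finite homogeneous function `N`, and the `K_{θ,2}` norm of a
functional in the dual pair is the best constant in its bound against `N`. -/
theorem exists_Knorm2E_duality {θ : ℝ} (hθ0 : 0 < θ) (hθ1 : θ < 1)
    (i0 : Function.Injective P.jd0) (i1 : Function.Injective P.jd1) (ψ : P.deltaSub →L[ℂ] ℂ) :
    ∃ N : P.deltaSub → ℝ,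
      (∀ p, 0 ≤ N p ∧ P.Knorm2E θ (P.j0 (p : H0 × H1).1) = ENNReal.ofReal (N p)) ∧
      (∀ (c : ℝ) p, 0 ≤ c → N ((c : ℂ) • p) = c * N p) ∧
      (ψ ∈ (CompatiblePair.mk P.jd0 P.jd1 i0 i1).Kmem θ 2 ↔
        (CompatiblePair.mk P.jd0 P.jd1 i0 i1).Knorm2E θ ψ ≠ ⊤) ∧
      ((CompatiblePair.mk P.jd0 P.jd1 i0 i1).Knorm2E θ ψ ≠ ⊤ →
        ∀ p, ‖ψ p‖ ≤ ((CompatiblePair.mk P.jd0 P.jd1 i0 i1).Knorm2E θ ψ).toReal * N p) ∧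
      ∀ C : ℝ, 0 ≤ C → (∀ p, ‖ψ p‖ ≤ C * N p) →
        (CompatiblePair.mk P.jd0 P.jd1 i0 i1).Knorm2E θ ψ ≤ ENNReal.ofReal C := by
  obtain ⟨E, ι, T0, T1, _, hι, hu, h0, h1, hT⟩ := P.exists_hilbert_completion
  exact P.Knorm2E_duality_of_completion hθ0 hθ1 hT hι hu h0 h1 i0 i1 ψ

end CompatiblePair

/-- (Theorem 3.8(ii)/Remark.) Let `H̄ = (H0,H1)` be a compatible pair of
complex Hilbert spaces with `Δ(H̄)` dense in both `H0` and `H1`, so that each dual `H_j*`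
embeds injectively (by restriction) into `Δ(H̄)*` and `H̄* = (H0*,H1*)` is a compatible
pair. Then for `0 < θ < 1`, with the normalisation `N_{θ,2} = ((2/π) sin (πθ))^{1/2}`:
a functional `ψ ∈ Δ(H̄)*` extends boundedly to `K_{θ,2}(H̄)` (i.e. is bounded on the dense
subset `Δ(H̄)` in the `K_{θ,2}`-norm) if and only if `ψ ∈ K_{θ,2}(H̄*)`, and in that case
the dual norm of `ψ` equals `‖ψ‖_{K_{θ,2}(H̄*)}`. -/
theorem statement15
    {V H0 H1 : Type*} [AddCommGroup V] [Module ℂ V]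
    [NormedAddCommGroup H0] [InnerProductSpace ℂ H0] [CompleteSpace H0]
    [NormedAddCommGroup H1] [InnerProductSpace ℂ H1] [CompleteSpace H1]
    (P : CompatiblePair V H0 H1)
    (hdense0 : ∀ (a : H0) (ε : ℝ), 0 < ε → ∃ p : P.deltaSub, ‖a - (p : H0 × H1).1‖ < ε)
    (hdense1 : ∀ (b : H1) (ε : ℝ), 0 < ε → ∃ p : P.deltaSub, ‖b - (p : H0 × H1).2‖ < ε)
    (θ : ℝ) (hθ0 : 0 < θ) (hθ1 : θ < 1) :
    -- the restriction embeddings are injective, so `H̄* = (H0*, H1*)` is a compatible pair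
    Function.Injective P.jd0 ∧ Function.Injective P.jd1 ∧
    ∀ (h0 : Function.Injective P.jd0) (h1 : Function.Injective P.jd1),
      ∀ ψ : P.deltaSub →L[ℂ] ℂ,
        -- `ψ` extends to a bounded linear functional on `K_{θ,2}(H̄)` iff `ψ ∈ K_{θ,2}(H̄*)`
        ((∃ C : ℝ, 0 ≤ C ∧ ∀ p : P.deltaSub,
            ENNReal.ofReal ‖ψ p‖ ≤ ENNReal.ofReal C * P.Knorm2E θ (P.j0 (p : H0 × H1).1)) ↔
          ψ ∈ (CompatiblePair.mk P.jd0 P.jd1 h0 h1).Kmem θ 2) ∧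
        -- and in that case the dual norm of `ψ` on `K_{θ,2}(H̄)` equals `‖ψ‖_{K_{θ,2}(H̄*)}`
        (ψ ∈ (CompatiblePair.mk P.jd0 P.jd1 h0 h1).Kmem θ 2 →
          sSup {r : ℝ≥0∞ | ∃ p : P.deltaSub,
              P.Knorm2E θ (P.j0 (p : H0 × H1).1) ≤ 1 ∧ r = ENNReal.ofReal ‖ψ p‖} =
            (CompatiblePair.mk P.jd0 P.jd1 h0 h1).Knorm2E θ ψ) := by
  refine ⟨P.jd0_injective hdense0, P.jd1_injective hdense1, fun h0 h1 ψ => ?_⟩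
  obtain ⟨N, hN, hsmul, hmem, hle, hge⟩ := P.exists_Knorm2E_duality hθ0 hθ1 h0 h1 ψ
  set M := (CompatiblePair.mk P.jd0 P.jd1 h0 h1).Knorm2E θ ψ
  have hbound : ∀ C : ℝ, 0 ≤ C → ((∀ p : P.deltaSub, ENNReal.ofReal ‖ψ p‖ ≤
      ENNReal.ofReal C * P.Knorm2E θ (P.j0 (p : H0 × H1).1)) ↔ ∀ p, ‖ψ p‖ ≤ C * N p) :=
    fun C hC => forall_congr' fun p => by
      rw [(hN p).2, ← ENNReal.ofReal_mul hC,
        ENNReal.ofReal_le_ofReal_iff (mul_nonneg hC (hN p).1)]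
  rw [hmem]
  refine ⟨⟨?_, fun hfin => ⟨M.toReal, ENNReal.toReal_nonneg,
    (hbound _ ENNReal.toReal_nonneg).2 (hle hfin)⟩⟩, fun hfin => le_antisymm ?_ ?_⟩
  · rintro ⟨C, hC, h⟩
    exact ne_top_of_le_ne_top ENNReal.ofReal_ne_top (hge C hC ((hbound C hC).1 h))
  · refine sSup_le ?_
    rintro _ ⟨p, hp, rfl⟩
    rw [(hN p).2, ENNReal.ofReal_le_one] at hp
    exact ENNReal.ofReal_le_of_le_toReal
      ((hle hfin p).trans (mul_le_of_le_one_right ENNReal.toReal_nonneg hp))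
  · set S := sSup {r : ℝ≥0∞ | ∃ p : P.deltaSub,
      P.Knorm2E θ (P.j0 (p : H0 × H1).1) ≤ 1 ∧ r = ENNReal.ofReal ‖ψ p‖} with hS
    rcases eq_or_ne S ⊤ with h | hStop
    · exact h ▸ le_top
    rw [← ENNReal.ofReal_toReal hStop]
    refine hge _ ENNReal.toReal_nonneg fun p => ?_
    rcases (hN p).1.eq_or_lt with hp | hp
    · simpa [← hp] using hle hfin p
    let q : P.deltaSub := (((N p)⁻¹ : ℝ) : ℂ) • p
    have hq : ENNReal.ofReal ‖ψ q‖ ≤ S := le_sSup ⟨q, by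
      rw [(hN q).2, hsmul _ p (inv_nonneg.2 hp.le), inv_mul_cancel₀ hp.ne', ENNReal.ofReal_one],
      rfl⟩
    rw [ENNReal.ofReal_le_iff_le_toReal hStop, map_smul, norm_smul, Complex.norm_real,
      Real.norm_of_nonneg (inv_nonneg.2 hp.le), inv_mul_le_iff₀ hp] at hq
    rwa [mul_comm]
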